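/- Let (α_n) and (β_n) be sequences with α_n, β_n > −1 such that α_n/n → ∞ and β_n/n → b for some b ≥ 0 as n → ∞. Let r_n and s_n denote, respectively, the smallest and largest zero of P_n^{(α_n,β_n)}. Then lim_{n→∞} (α_n/n)·(s_n + 1) = 2(2+b) + 4√(1+b) and lim_{n→∞} (α_n/n)·(r_n + 1) = 2(2+b) − 4√(1+b). Moreover, the closure of the set ⋃_{n≥1} { (α_n/n)·(x + 1) : P_n^{(α_n,β_n)}(x) = 0 } contains the interval [2(2+b) − 4√(1+b), 2(2+b) + 4√(1+b)]. -/

import Mathlib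

open Filter Topology

/-- Generalized binomial coefficient C(t, m) = t(t-1)⋯(t-m+1)/m! for real t. -/
noncomputable def genBinom (t : ℝ) (m : ℕ) : ℝ :=
  (∏ i ∈ Finset.range m, (t - (i : ℝ))) / (Nat.factorial m)

/-- Jacobi polynomial P_n^{(α,β)}. -/
noncomputable def jacobiP (n : ℕ) (α β : ℝ) (x : ℝ) : ℝ :=
  ∑ k ∈ Finset.range (n + 1),
    genBinom ((n : ℝ) + α) (n - k) * genBinom ((n : ℝ) + β) k *
      ((x - 1) / 2) ^ k * ((x + 1) / 2) ^ (n - k)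

/-- Number of zeros of P_n^{(α,β)} that are ≤ ξ. -/
noncomputable def jacobiN (n : ℕ) (α β ξ : ℝ) : ℕ :=
  {x : ℝ | jacobiP n α β x = 0 ∧ x ≤ ξ}.ncard

lemma genBinom_succ (t : ℝ) (m : ℕ) :
    genBinom t (m + 1) * (m + 1) = genBinom t m * (t - m) := by
  have h1 : (m.factorial : ℝ) ≠ 0 := by positivity
  have h2 : (m : ℝ) + 1 ≠ 0 := by positivity
  unfold genBinom
  rw [Finset.prod_range_succ, Nat.factorial_succ]
  push_cast
  field_simp

lemma genBinom_pos {t : ℝ} {m : ℕ} (h : (m : ℝ) - 1 < t) : 0 < genBinom t m := by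
  unfold genBinom
  refine div_pos (Finset.prod_pos fun i hi => ?_) (by positivity)
  have : (i : ℝ) + 1 ≤ m := by exact_mod_cast Finset.mem_range.1 hi
  linarith

/-- The coefficient of `((x - 1) / 2) ^ k * ((x + 1) / 2) ^ (n - k)` in `jacobiP n α β x`. -/
noncomputable def jacobiCoeff (n : ℕ) (α β : ℝ) (k : ℕ) : ℝ :=
  genBinom ((n : ℝ) + α) (n - k) * genBinom ((n : ℝ) + β) k

lemma jacobiP_eq_sum (n : ℕ) (α β x : ℝ) :
    jacobiP n α β x = ∑ k ∈ Finset.range (n + 1),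
      jacobiCoeff n α β k * (((x - 1) / 2) ^ k * ((x + 1) / 2) ^ (n - k)) := by
  unfold jacobiP jacobiCoeff
  exact Finset.sum_congr rfl fun k _ => by ring

lemma jacobiCoeff_pos {n k : ℕ} {α β : ℝ} (hα : -1 < α) (hβ : -1 < β) (hk : k ≤ n) :
    0 < jacobiCoeff n α β k := by
  have h : (k : ℝ) ≤ n := by exact_mod_cast hk
  refine mul_pos (genBinom_pos ?_) (genBinom_pos (by linarith))
  rw [Nat.cast_sub hk]
  linarith [k.cast_nonneg (α := ℝ)]

lemma jacobiCoeff_succ {n k : ℕ} (α β : ℝ) (hk : k < n) :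
    jacobiCoeff n α β (k + 1) * (k + 1) * (k + 1 + α) =
      jacobiCoeff n α β k * (n - k) * (n - k + β) := by
  obtain ⟨m, rfl⟩ : ∃ m, n = k + (m + 1) := ⟨n - k - 1, by omega⟩
  have e1 : k + (m + 1) - (k + 1) = m := by omega
  have e2 : k + (m + 1) - k = m + 1 := by omega
  unfold jacobiCoeff
  rw [e1, e2]
  have h1 := genBinom_succ (((k + (m + 1) : ℕ) : ℝ) + α) m
  have h2 := genBinom_succ (((k + (m + 1) : ℕ) : ℝ) + β) k
  push_cast at h1 h2 ⊢
  linear_combination genBinom (k + (m + 1) + α) m * (k + 1 + α) * h2 -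
    genBinom (k + (m + 1) + β) k * (m + 1 + β) * h1

lemma jacobiP_neg (n : ℕ) (α β x : ℝ) :
    jacobiP n α β (-x) = (-1) ^ n * jacobiP n β α x := by
  unfold jacobiP
  rw [← Finset.sum_range_reflect, Finset.mul_sum]
  refine Finset.sum_congr rfl fun k hk => ?_
  have hk : k ≤ n := Nat.lt_succ_iff.1 (Finset.mem_range.1 hk)
  obtain ⟨m, rfl⟩ := Nat.exists_eq_add_of_le hk
  have e1 : k + m + 1 - 1 - k = m := by omega
  have e2 : k + m - m = k := by omega
  have e3 : k + m - k = m := by omega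
  rw [e1, e2, e3, show (-x - 1) / 2 = -1 * ((x + 1) / 2) by ring,
    show (-x + 1) / 2 = -1 * ((x - 1) / 2) by ring, mul_pow, mul_pow, pow_add]
  ring

lemma jacobiP_pos_of_one_le {n : ℕ} {α β x : ℝ} (hα : -1 < α) (hβ : -1 < β) (hx : 1 ≤ x) :
    0 < jacobiP n α β x := by
  rw [jacobiP_eq_sum]
  have h1 : 0 ≤ (x - 1) / 2 := by linarith
  have h2 : 0 < (x + 1) / 2 := by linarith
  refine Finset.sum_pos' (fun k hk => ?_) ⟨0, by simp, ?_⟩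
  · have := jacobiCoeff_pos hα hβ (Nat.lt_succ_iff.1 (Finset.mem_range.1 hk))
    positivity
  · have := jacobiCoeff_pos hα hβ n.zero_le
    simp only [pow_zero, one_mul]
    positivity

lemma jacobiP_ne_zero_of_le_neg_one {n : ℕ} {α β x : ℝ} (hα : -1 < α) (hβ : -1 < β)
    (hx : x ≤ -1) : jacobiP n α β x ≠ 0 := by
  rw [← neg_neg x, jacobiP_neg]
  exact mul_ne_zero (by simp) (jacobiP_pos_of_one_le hβ hα (by linarith)).ne'

lemma mem_Ioo_of_jacobiP_eq_zero {n : ℕ} {α β x : ℝ} (hα : -1 < α) (hβ : -1 < β)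
    (hx : jacobiP n α β x = 0) : x ∈ Set.Ioo (-1 : ℝ) 1 := by
  constructor
  · by_contra! h
    exact jacobiP_ne_zero_of_le_neg_one hα hβ h hx
  · by_contra! h
    exact (jacobiP_pos_of_one_le hα hβ h).ne' hx

/-- The derivative of `jacobiP n α β`. -/
noncomputable def jacobiP' (n : ℕ) (α β x : ℝ) : ℝ :=
  ∑ k ∈ Finset.range (n + 1), jacobiCoeff n α β k *
    ((k * ((x - 1) / 2) ^ (k - 1) * ((x + 1) / 2) ^ (n - k) +
      (n - k : ℕ) * ((x - 1) / 2) ^ k * ((x + 1) / 2) ^ (n - k - 1)) / 2)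

/-- The second derivative of `jacobiP n α β`. -/
noncomputable def jacobiP'' (n : ℕ) (α β x : ℝ) : ℝ :=
  ∑ k ∈ Finset.range (n + 1), jacobiCoeff n α β k *
    ((k * ((k - 1 : ℕ) * ((x - 1) / 2) ^ (k - 1 - 1)) * ((x + 1) / 2) ^ (n - k) +
      2 * (k * ((x - 1) / 2) ^ (k - 1)) * ((n - k : ℕ) * ((x + 1) / 2) ^ (n - k - 1)) +
      ((x - 1) / 2) ^ k *
        ((n - k : ℕ) * ((n - k - 1 : ℕ) * ((x + 1) / 2) ^ (n - k - 1 - 1)))) / 4)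

lemma hasDerivAt_half_add_pow (c x : ℝ) (k : ℕ) :
    HasDerivAt (fun x : ℝ => ((x + c) / 2) ^ k) (k * ((x + c) / 2) ^ (k - 1) / 2) x := by
  refine ((((hasDerivAt_id' x).add_const c).div_const 2).fun_pow k).congr_deriv ?_
  ring

lemma hasDerivAt_half_sub_pow (c x : ℝ) (k : ℕ) :
    HasDerivAt (fun x : ℝ => ((x - c) / 2) ^ k) (k * ((x - c) / 2) ^ (k - 1) / 2) x := by
  simpa only [sub_eq_add_neg] using hasDerivAt_half_add_pow (-c) x k

lemma hasDerivAt_jacobiP (n : ℕ) (α β x : ℝ) :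
    HasDerivAt (jacobiP n α β) (jacobiP' n α β x) x := by
  rw [show jacobiP n α β = _ from funext (jacobiP_eq_sum n α β)]
  refine HasDerivAt.fun_sum fun k _ => ?_
  refine (((hasDerivAt_half_sub_pow 1 x k).fun_mul (hasDerivAt_half_add_pow 1 x (n - k))).const_mul
    (jacobiCoeff n α β k)).congr_deriv ?_
  ring

lemma hasDerivAt_jacobiP' (n : ℕ) (α β x : ℝ) :
    HasDerivAt (jacobiP' n α β) (jacobiP'' n α β x) x := by
  unfold jacobiP' jacobiP''
  refine HasDerivAt.fun_sum fun k _ => ?_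
  refine ((((((hasDerivAt_half_sub_pow 1 x (k - 1)).const_mul (k : ℝ)).fun_mul
    (hasDerivAt_half_add_pow 1 x (n - k))).fun_add
    (((hasDerivAt_half_sub_pow 1 x k).const_mul ((n - k : ℕ) : ℝ)).fun_mul
    (hasDerivAt_half_add_pow 1 x (n - k - 1)))).div_const 2).const_mul
    (jacobiCoeff n α β k)).congr_deriv ?_
  ring

lemma mul_cast_mul_pow_pred (a : ℝ) (k : ℕ) : a * (k * a ^ (k - 1)) = k * a ^ k := by
  cases k with
  | zero => simp
  | succ k => simp [pow_succ]; ring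

lemma mul_cast_mul_pow_pred_pred (a : ℝ) (k : ℕ) :
    a * (k * ((k - 1 : ℕ) * a ^ (k - 1 - 1))) = (k - 1) * (k * a ^ (k - 1)) := by
  rcases k with _ | k
  · simp
  · have := mul_cast_mul_pow_pred a k
    simp only [Nat.add_sub_cancel]
    push_cast
    linear_combination ((k : ℝ) + 1) * this

/-- The Jacobi differential equation. -/
lemma jacobiP_ode (n : ℕ) (α β x : ℝ) :
    (1 - x ^ 2) * jacobiP'' n α β x + (β - α - (α + β + 2) * x) * jacobiP' n α β x +
      n * (n + α + β + 1) * jacobiP n α β x = 0 := by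
  set a := (x - 1) / 2 with ha
  set c := (x + 1) / 2 with hc
  have hx : x = a + c := by rw [ha, hc]; ring
  have hac : c = a + 1 := by rw [ha, hc]; ring
  set F : ℕ → ℝ := fun k =>
    jacobiCoeff n α β k * (k + α) * (k * a ^ (k - 1)) * c ^ (n - k) * c with hF
  set H : ℕ → ℝ := fun k => jacobiCoeff n α β k * k * (k + α) * (a ^ k * c ^ (n - k)) with hH
  have key : (1 - x ^ 2) * jacobiP'' n α β x + (β - α - (α + β + 2) * x) * jacobiP' n α β x +
      n * (n + α + β + 1) * jacobiP n α β x =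
      ∑ k ∈ Finset.range (n + 1), ((if k < n then F (k + 1) - H (k + 1) else 0) -
        (F k - H k)) := by
    rw [jacobiP_eq_sum, jacobiP', jacobiP'', Finset.mul_sum, Finset.mul_sum, Finset.mul_sum,
      ← Finset.sum_add_distrib, ← Finset.sum_add_distrib]
    refine Finset.sum_congr rfl fun k hk => ?_
    have hk : k ≤ n := Nat.lt_succ_iff.1 (Finset.mem_range.1 hk)
    rw [← ha, ← hc]
    obtain ⟨m, rfl⟩ := Nat.exists_eq_add_of_le hk
    have hm : k + m - k = m := by omega
    have hcoef : (if k < k + m then F (k + 1) - H (k + 1) else 0) =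
        jacobiCoeff (k + m) α β k * (m + β) * (m * a ^ k * c ^ m -
          a ^ k * a * (m * c ^ (m - 1))) := by
      rcases m with _ | m
      · simp
      · have h := jacobiCoeff_succ α β (show k < k + (m + 1) by omega)
        have e : k + (m + 1) - (k + 1) = m := by omega
        rw [if_pos (by omega), hF, hH]
        simp only [e, Nat.add_sub_cancel]
        push_cast at h ⊢
        linear_combination (a ^ k * c ^ m * c - a ^ k * a * c ^ m) * h
    rw [hcoef, hF, hH]
    simp only [hm]
    have p1 := mul_cast_mul_pow_pred a k
    have p2 := mul_cast_mul_pow_pred_pred a k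
    have q1 := mul_cast_mul_pow_pred c m
    have q2 := mul_cast_mul_pow_pred_pred c m
    have hσ : 1 - x ^ 2 = -4 * a * c := by rw [ha, hc]; ring
    have hτ : β - α - (α + β + 2) * x = -2 * ((α + 1) * c + (β + 1) * a) := by
      rw [ha, hc]; ring
    rw [hσ, hτ]
    push_cast
    linear_combination jacobiCoeff (k + m) α β k *
      (-c * c ^ m * p2 - 2 * c * (m * c ^ (m - 1)) * p1 - 2 * k * a ^ k * q1 - a * a ^ k * q2 -
        (α + 1) * a ^ k * q1 - (β + 1) * c ^ m * p1)
  rw [key, Finset.sum_sub_distrib, Finset.sum_range_succ, Finset.sum_range_succ', if_neg (by simp),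
    Finset.sum_congr rfl fun k hk => if_pos (Finset.mem_range.1 hk)]
  simp [hF, hH]

/-- A function `φ` with second derivative `Q φ`, where `0 ≤ Q`, that vanishes at both ends of an interval is zero. -/
lemma eq_zero_of_deriv_deriv_eq_nonneg_mul {φ dφ Q : ℝ → ℝ} {u v : ℝ}
    (hc : ContinuousOn φ (Set.Icc u v))
    (h1 : ∀ x ∈ Set.Ioo u v, HasDerivAt φ (dφ x) x)
    (h2 : ∀ x ∈ Set.Ioo u v, HasDerivAt dφ (Q x * φ x) x)
    (hQ : ∀ x ∈ Set.Ioo u v, 0 ≤ Q x) (hu : φ u = 0) (hv : φ v = 0) :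
    ∀ x ∈ Set.Icc u v, φ x = 0 := by
  intro x hx
  have hconv : ConvexOn ℝ (Set.Icc u v) fun x => φ x ^ 2 := by
    refine convexOn_of_hasDerivWithinAt2_nonneg (convex_Icc u v) (hc.pow 2)
      (f' := fun x => 2 * (φ x * dφ x))
      (f'' := fun x => 2 * (dφ x * dφ x + φ x * (Q x * φ x))) ?_ ?_ ?_ <;>
      rw [interior_Icc] <;> intro y hy
    · exact ((((h1 y hy).fun_pow 2).congr_deriv (by ring)).hasDerivWithinAt)
    · exact (((h1 y hy).fun_mul (h2 y hy)).const_mul 2).hasDerivWithinAt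
    · have := mul_nonneg (hQ y hy) (sq_nonneg (φ y))
      nlinarith [sq_nonneg (dφ y)]
  have huv : u ≤ v := hx.1.trans hx.2
  have hle := hconv.le_max_of_mem_Icc (Set.left_mem_Icc.2 huv) (Set.right_mem_Icc.2 huv) hx
  simp only [hu, hv, max_self] at hle
  exact pow_eq_zero_iff two_ne_zero |>.1 (le_antisymm (by simpa using hle) (sq_nonneg _))

/-- A function `φ` with second derivative `Q φ`, where `Q ≤ -K ^ 2`, has a zero in every interval
longer than `π / K`. -/
lemma exists_zero_of_deriv_deriv_eq_mul {φ dφ Q : ℝ → ℝ} {u v K : ℝ} (hK : 0 < K)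
    (hlen : Real.pi < K * (v - u))
    (h1 : ∀ x ∈ Set.Icc u v, HasDerivAt φ (dφ x) x)
    (h2 : ∀ x ∈ Set.Icc u v, HasDerivAt dφ (Q x * φ x) x)
    (hQ : ∀ x ∈ Set.Icc u v, Q x ≤ -K ^ 2) : ∃ x ∈ Set.Icc u v, φ x = 0 := by
  by_contra! hne
  have huv : u ≤ v := by
    by_contra! h
    nlinarith [Real.pi_pos]
  have hd : ∀ x ∈ Set.Icc u v, HasDerivAt (fun x => Real.arctan (dφ x / φ x / K) + K * x)
      (1 / (1 + (dφ x / φ x / K) ^ 2) *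
        ((Q x * φ x * φ x - dφ x * dφ x) / φ x ^ 2 / K) + K) x := by
    intro x hx
    exact (((h2 x hx).fun_div (h1 x hx) (hne x hx)).div_const K).arctan.fun_add
      (((hasDerivAt_id' x).const_mul K).congr_deriv (mul_one K))
  have hanti := antitoneOn_of_deriv_nonpos (convex_Icc u v)
    (fun x hx => (hd x hx).continuousAt.continuousWithinAt)
    (fun x hx => (hd x (interior_subset hx)).differentiableAt.differentiableWithinAt)
    (fun x hx => by
      have hx := interior_subset hx
      rw [(hd x hx).deriv]
      have hφ := hne x hx
      have hpos : 0 < 1 + (dφ x / φ x / K) ^ 2 := by positivity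
      have key : (Q x * φ x * φ x - dφ x * dφ x) / φ x ^ 2 / K ≤
          -K * (1 + (dφ x / φ x / K) ^ 2) := by
        have e : (Q x * φ x * φ x - dφ x * dφ x) / φ x ^ 2 / K =
            Q x / K - K * (dφ x / φ x / K) ^ 2 := by field_simp
        have : Q x / K ≤ -K := by
          rw [div_le_iff₀ hK]
          linarith [hQ x hx]
        linarith
      rw [one_div_mul_eq_div, ← le_neg_iff_add_nonpos_right, div_le_iff₀ hpos]
      exact key)
  have h := hanti (Set.left_mem_Icc.2 huv) (Set.right_mem_Icc.2 huv) huv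
  simp only at h
  linarith [Real.arctan_lt_pi_div_two (dφ u / φ u / K),
    Real.neg_pi_div_two_lt_arctan (dφ v / φ v / K)]

/-- The quadratic polynomial whose sign governs the oscillation of `jacobiP n α β`. -/
noncomputable def jacobiDiscr (n : ℕ) (α β x : ℝ) : ℝ :=
  (β - α - (α + β + 2) * x) ^ 2 + 4 * x * (β - α - (α + β + 2) * x) -
    (2 * (α + β + 2) + 4 * (n * (n + α + β + 1))) * (1 - x ^ 2)

/-- The square root of the Jacobi weight times `1 - x ^ 2`. -/
noncomputable def jacobiMult (α β x : ℝ) : ℝ :=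
  (1 - x) ^ ((α + 1) / 2) * (1 + x) ^ ((β + 1) / 2)

lemma jacobiMult_pos {x : ℝ} (α β : ℝ) (hx : x ∈ Set.Ioo (-1 : ℝ) 1) : 0 < jacobiMult α β x :=
  mul_pos (Real.rpow_pos_of_pos (by linarith [hx.2]) _)
    (Real.rpow_pos_of_pos (by linarith [hx.1]) _)

lemma continuous_jacobiMult {α β : ℝ} (hα : -1 < α) (hβ : -1 < β) :
    Continuous (jacobiMult α β) := by
  unfold jacobiMult
  exact ((continuous_const.sub continuous_id).rpow_const fun _ => Or.inr (by linarith)).mul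
    ((continuous_const.add continuous_id).rpow_const fun _ => Or.inr (by linarith))

lemma jacobiMult_neg_one {α β : ℝ} (hβ : -1 < β) : jacobiMult α β (-1) = 0 := by
  simp [jacobiMult, Real.zero_rpow (show (β + 1) / 2 ≠ 0 by linarith)]

lemma jacobiMult_one {α β : ℝ} (hα : -1 < α) : jacobiMult α β 1 = 0 := by
  simp [jacobiMult, Real.zero_rpow (show (α + 1) / 2 ≠ 0 by linarith)]

lemma one_sub_sq_pos {x : ℝ} (hx : x ∈ Set.Ioo (-1 : ℝ) 1) : 0 < 1 - x ^ 2 := by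
  nlinarith [hx.1, hx.2]

lemma hasDerivAt_jacobiMult {x : ℝ} (α β : ℝ) (hx : x ∈ Set.Ioo (-1 : ℝ) 1) :
    HasDerivAt (jacobiMult α β)
      (jacobiMult α β x * ((β - α - (α + β + 2) * x) / (2 * (1 - x ^ 2)))) x := by
  have h1 : 0 < 1 - x := by linarith [hx.2]
  have h2 : 0 < 1 + x := by linarith [hx.1]
  have hσ : 1 - x ^ 2 = (1 - x) * (1 + x) := by ring
  refine ((((hasDerivAt_id' x).const_sub 1).rpow_const (p := (α + 1) / 2)
    (Or.inl h1.ne')).fun_mul (((hasDerivAt_id' x).const_add 1).rpow_const (p := (β + 1) / 2)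
    (Or.inl h2.ne'))).congr_deriv ?_
  rw [Real.rpow_sub_one h1.ne', Real.rpow_sub_one h2.ne', jacobiMult, hσ]
  field_simp
  ring

/-- The derivative of `jacobiMult α β * jacobiP n α β`. -/
noncomputable def jacobiNormal' (n : ℕ) (α β x : ℝ) : ℝ :=
  jacobiMult α β x * (jacobiP' n α β x +
    (β - α - (α + β + 2) * x) / (2 * (1 - x ^ 2)) * jacobiP n α β x)

lemma hasDerivAt_jacobiNormal {x : ℝ} (n : ℕ) (α β : ℝ) (hx : x ∈ Set.Ioo (-1 : ℝ) 1) :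
    HasDerivAt (fun x => jacobiMult α β x * jacobiP n α β x) (jacobiNormal' n α β x) x := by
  refine ((hasDerivAt_jacobiMult α β hx).fun_mul (hasDerivAt_jacobiP n α β x)).congr_deriv ?_
  unfold jacobiNormal'
  ring

lemma hasDerivAt_jacobiNormal' {x : ℝ} (n : ℕ) (α β : ℝ) (hx : x ∈ Set.Ioo (-1 : ℝ) 1) :
    HasDerivAt (jacobiNormal' n α β)
      (jacobiDiscr n α β x / (4 * (1 - x ^ 2) ^ 2) * (jacobiMult α β x * jacobiP n α β x)) x := by
  have hσ := one_sub_sq_pos hx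
  have hτ : HasDerivAt (fun x => (β - α - (α + β + 2) * x) / (2 * (1 - x ^ 2)))
      ((-(α + β + 2) * (2 * (1 - x ^ 2)) - (β - α - (α + β + 2) * x) * (2 * (-(2 * x)))) /
        (2 * (1 - x ^ 2)) ^ 2) x := by
    refine ((((hasDerivAt_id' x).const_mul (α + β + 2)).const_sub (β - α)).fun_div
      ((((hasDerivAt_id' x).fun_pow 2).const_sub 1).const_mul 2) (by positivity)).congr_deriv ?_
    ring
  refine ((hasDerivAt_jacobiMult α β hx).fun_mul ((hasDerivAt_jacobiP' n α β x).fun_add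
    (hτ.fun_mul (hasDerivAt_jacobiP n α β x)))).congr_deriv ?_
  have hode := jacobiP_ode n α β x
  have hy : jacobiP'' n α β x = -((β - α - (α + β + 2) * x) * jacobiP' n α β x +
      n * (n + α + β + 1) * jacobiP n α β x) / (1 - x ^ 2) := by
    rw [eq_div_iff hσ.ne']
    linear_combination hode
  rw [hy, jacobiDiscr]
  field_simp
  ring

/-- `x₀` is not a zero if the discriminant is nonnegative between `x₀` and `1`. -/
lemma jacobiP_ne_zero_of_jacobiDiscr_nonneg_right {n : ℕ} {α β x₀ : ℝ} (hα : -1 < α)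
    (hβ : -1 < β) (h₀ : x₀ ∈ Set.Ioo (-1 : ℝ) 1)
    (hD : ∀ x ∈ Set.Ioo x₀ 1, 0 ≤ jacobiDiscr n α β x) : jacobiP n α β x₀ ≠ 0 := by
  intro hz
  have hcP : Continuous (jacobiP n α β) :=
    continuous_iff_continuousAt.2 fun x => (hasDerivAt_jacobiP n α β x).continuousAt
  have hsub : Set.Ioo x₀ 1 ⊆ Set.Ioo (-1 : ℝ) 1 := Set.Ioo_subset_Ioo_left h₀.1.le
  have hzero := eq_zero_of_deriv_deriv_eq_nonneg_mul
    ((continuous_jacobiMult hα hβ).mul hcP).continuousOn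
    (fun x hx => hasDerivAt_jacobiNormal n α β (hsub hx))
    (fun x hx => hasDerivAt_jacobiNormal' n α β (hsub hx))
    (fun x hx => div_nonneg (hD x hx) (by positivity))
    (by simp [hz]) (by simp [jacobiMult_one hα])
  have hev : Set.EqOn (jacobiP n α β) 0 (Set.Ioo x₀ 1) := fun x hx =>
    (mul_eq_zero.1 (hzero x (Set.Ioo_subset_Icc_self hx))).resolve_left
      (jacobiMult_pos α β (hsub hx)).ne'
  have hcl := hev.closure hcP continuous_const
  rw [closure_Ioo h₀.2.ne] at hcl
  exact (jacobiP_pos_of_one_le hα hβ le_rfl).ne' (hcl (Set.right_mem_Icc.2 h₀.2.le))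

lemma jacobiDiscr_neg (n : ℕ) (α β x : ℝ) : jacobiDiscr n α β (-x) = jacobiDiscr n β α x := by
  unfold jacobiDiscr
  ring

lemma jacobiP_ne_zero_of_jacobiDiscr_nonneg_left {n : ℕ} {α β x₀ : ℝ} (hα : -1 < α)
    (hβ : -1 < β) (h₀ : x₀ ∈ Set.Ioo (-1 : ℝ) 1)
    (hD : ∀ x ∈ Set.Ioo (-1) x₀, 0 ≤ jacobiDiscr n α β x) : jacobiP n α β x₀ ≠ 0 := by
  rw [← neg_neg x₀, jacobiP_neg]
  refine mul_ne_zero (by simp) (jacobiP_ne_zero_of_jacobiDiscr_nonneg_right hβ hα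
    ⟨by linarith [h₀.2], by linarith [h₀.1]⟩ fun x hx => ?_)
  rw [← jacobiDiscr_neg]
  exact hD _ ⟨by linarith [hx.2], by linarith [hx.1]⟩

lemma exists_jacobiP_eq_zero {n : ℕ} {α β u v K : ℝ} (hu : -1 < u) (hv : v < 1) (hK : 0 < K)
    (hlen : Real.pi < K * (v - u))
    (hD : ∀ x ∈ Set.Icc u v, jacobiDiscr n α β x ≤ -K ^ 2 * (4 * (1 - x ^ 2) ^ 2)) :
    ∃ x ∈ Set.Icc u v, jacobiP n α β x = 0 := by
  have hsub : Set.Icc u v ⊆ Set.Ioo (-1 : ℝ) 1 := fun x hx =>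
    ⟨hu.trans_le hx.1, hx.2.trans_lt hv⟩
  obtain ⟨x, hx, h⟩ := exists_zero_of_deriv_deriv_eq_mul hK hlen
    (fun x hx => hasDerivAt_jacobiNormal n α β (hsub hx))
    (fun x hx => hasDerivAt_jacobiNormal' n α β (hsub hx))
    (fun x hx => by
      have := one_sub_sq_pos (hsub hx)
      rw [div_le_iff₀ (by positivity)]
      exact hD x hx)
  exact ⟨x, hx, (mul_eq_zero.1 h).resolve_left (jacobiMult_pos α β (hsub hx)).ne'⟩

/-- `jacobiDiscr` is a convex quadratic polynomial. -/
lemma exists_jacobiDiscr_eq_quadratic {n : ℕ} {α β : ℝ} (hn : 1 ≤ n) (hα : -1 < α)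
    (hβ : -1 < β) : ∃ a b c : ℝ, 0 ≤ a ∧ ∀ x, jacobiDiscr n α β x = a * x ^ 2 + b * x + c := by
  have hn : (1 : ℝ) ≤ n := by exact_mod_cast hn
  refine ⟨(α + β + 1 + 2 * n) ^ 2 - 1,
    -2 * (β - α) * (α + β + 2) + 4 * (β - α),
    (β - α) ^ 2 - (2 * (α + β + 2) + 4 * (n * (n + α + β + 1))), ?_, fun x => ?_⟩
  · nlinarith
  · unfold jacobiDiscr
    ring

lemma convexOn_jacobiDiscr {n : ℕ} {α β : ℝ} (hn : 1 ≤ n) (hα : -1 < α) (hβ : -1 < β) :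
    ConvexOn ℝ Set.univ (jacobiDiscr n α β) := by
  obtain ⟨a, b, c, ha, h⟩ := exists_jacobiDiscr_eq_quadratic hn hα hβ
  rw [show jacobiDiscr n α β = _ from funext h]
  refine ⟨convex_univ, fun x _ y _ s t hs ht hst => ?_⟩
  obtain rfl : t = 1 - s := by linarith
  simp only [smul_eq_mul]
  nlinarith [mul_nonneg ha (mul_nonneg (mul_nonneg hs ht) (sq_nonneg (x - y)))]

/-- `jacobiDiscr n α β`, rescaled at `-1` by `α / n` and divided by `n ^ 2`. -/
noncomputable def scaledDiscr (n : ℕ) (α β t : ℝ) : ℝ :=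
  jacobiDiscr n α β (-1 + n / α * t) / n ^ 2

lemma convexOn_scaledDiscr {n : ℕ} {α β : ℝ} (hn : 1 ≤ n) (hα : -1 < α) (hβ : -1 < β) :
    ConvexOn ℝ Set.univ (scaledDiscr n α β) := by
  refine ⟨convex_univ, fun x _ y _ s t hs ht hst => ?_⟩
  have h := (convexOn_jacobiDiscr hn hα hβ).2 (Set.mem_univ (-1 + n / α * x))
    (Set.mem_univ (-1 + n / α * y)) hs ht hst
  simp only [smul_eq_mul, scaledDiscr] at h ⊢
  rw [mul_div_assoc', mul_div_assoc', ← add_div]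
  refine div_le_div_of_nonneg_right (le_trans (le_of_eq ?_) h) (by positivity)
  congr 1
  linear_combination hst

lemma scaledDiscr_eq {n : ℕ} {α : ℝ} (β t : ℝ) (hn : 1 ≤ n) (hα : α ≠ 0) {h u c : ℝ}
    (hh : h = n / α) (hu : u = 1 / n) (hc : c = β / n) :
    scaledDiscr n α β t =
      (2 * (c + u) - (1 + (c + 2 * u) * h) * t) ^ 2 +
      4 * (h * t - 1) * (2 * (c + u) - (1 + (c + 2 * u) * h) * t) * u -
      (2 * ((1 + (c + 2 * u) * h) * u) + 4 * (h * (1 + c + u) + 1)) * (t * (2 - h * t)) := by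
  have hn : (n : ℝ) ≠ 0 := by positivity
  subst hh hu hc
  unfold scaledDiscr jacobiDiscr
  field_simp
  ring

section Asymptotics

variable {α β : ℕ → ℝ} {b : ℝ}

lemma eventually_pos_of_tendsto_div (hαlim : Tendsto (fun n : ℕ => α n / n) atTop atTop) :
    ∀ᶠ n : ℕ in atTop, 1 ≤ n ∧ 0 < α n := by
  filter_upwards [eventually_ge_atTop 1, hαlim.eventually_gt_atTop 0] with n hn h
  refine ⟨hn, ?_⟩
  have : (0 : ℝ) < n := by exact_mod_cast hn
  exact (div_pos_iff_of_pos_right this).1 h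

lemma tendsto_scaledDiscr (hαlim : Tendsto (fun n : ℕ => α n / n) atTop atTop)
    (hβlim : Tendsto (fun n : ℕ => β n / n) atTop (𝓝 b)) (t : ℝ) :
    Tendsto (fun n => scaledDiscr n (α n) (β n) t) atTop
      (𝓝 (t ^ 2 - (4 * b + 8) * t + 4 * b ^ 2)) := by
  have hh : Tendsto (fun n : ℕ => (n : ℝ) / α n) atTop (𝓝 0) := by
    simpa only [Function.comp_def, inv_div] using tendsto_inv_atTop_zero.comp hαlim
  have hu : Tendsto (fun n : ℕ => 1 / (n : ℝ)) atTop (𝓝 0) := tendsto_one_div_atTop_nhds_zero_nat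
  have hcont : Continuous fun p : ℝ × ℝ × ℝ =>
      (2 * (p.2.2 + p.2.1) - (1 + (p.2.2 + 2 * p.2.1) * p.1) * t) ^ 2 +
      4 * (p.1 * t - 1) * (2 * (p.2.2 + p.2.1) - (1 + (p.2.2 + 2 * p.2.1) * p.1) * t) * p.2.1 -
      (2 * ((1 + (p.2.2 + 2 * p.2.1) * p.1) * p.2.1) +
        4 * (p.1 * (1 + p.2.2 + p.2.1) + 1)) * (t * (2 - p.1 * t)) := by fun_prop
  have hlim := (hcont.tendsto (0, 0, b)).comp (hh.prodMk_nhds (hu.prodMk_nhds hβlim))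
  refine (hlim.congr' ?_).trans_eq ?_
  · filter_upwards [eventually_pos_of_tendsto_div hαlim] with n hn
    exact (scaledDiscr_eq (β n) t hn.1 hn.2.ne' rfl rfl rfl).symm
  · congr 1
    ring

end Asymptotics

/-- The left end of the limiting zero interval. -/
noncomputable def leftEnd (b : ℝ) : ℝ := 2 * (2 + b) - 4 * Real.sqrt (1 + b)

/-- The right end of the limiting zero interval. -/
noncomputable def rightEnd (b : ℝ) : ℝ := 2 * (2 + b) + 4 * Real.sqrt (1 + b)

lemma leftEnd_lt_rightEnd {b : ℝ} (hb : 0 ≤ b) : leftEnd b < rightEnd b := by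
  have : 0 < Real.sqrt (1 + b) := Real.sqrt_pos.2 (by linarith)
  unfold leftEnd rightEnd
  linarith

lemma sub_leftEnd_mul_sub_rightEnd {b : ℝ} (hb : 0 ≤ b) (t : ℝ) :
    t ^ 2 - (4 * b + 8) * t + 4 * b ^ 2 = (t - leftEnd b) * (t - rightEnd b) := by
  have := Real.sq_sqrt (show 0 ≤ 1 + b by linarith)
  unfold leftEnd rightEnd
  linear_combination 16 * this

lemma leftEnd_nonneg {b : ℝ} (hb : 0 ≤ b) : 0 ≤ leftEnd b := by
  have h1 := sub_leftEnd_mul_sub_rightEnd hb 0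
  have h2 := leftEnd_lt_rightEnd hb
  by_contra! h
  have h3 : 0 < rightEnd b := by
    have := Real.sqrt_nonneg (1 + b)
    unfold rightEnd
    linarith
  nlinarith [mul_pos_of_neg_of_neg h (neg_neg_of_pos h3)]

section Zeros

variable {α β : ℕ → ℝ} {b : ℝ}

lemma eventually_zero_lt (hb : 0 ≤ b) (hα : ∀ n, -1 < α n) (hβ : ∀ n, -1 < β n)
    (hαlim : Tendsto (fun n : ℕ => α n / n) atTop atTop)
    (hβlim : Tendsto (fun n : ℕ => β n / n) atTop (𝓝 b)) {d : ℝ} (hd : rightEnd b < d) :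
    ∀ᶠ n : ℕ in atTop, ∀ x, jacobiP n (α n) (β n) x = 0 → α n / n * (x + 1) < d := by
  have hAB := leftEnd_lt_rightEnd hb
  obtain ⟨c, hBc, hcd⟩ := exists_between hd
  have hc := tendsto_scaledDiscr hαlim hβlim c
  have hd' := tendsto_scaledDiscr hαlim hβlim d
  rw [sub_leftEnd_mul_sub_rightEnd hb] at hc hd'
  have hlt : (c - leftEnd b) * (c - rightEnd b) < (d - leftEnd b) * (d - rightEnd b) := by
    nlinarith
  filter_upwards [eventually_pos_of_tendsto_div hαlim, hc.eventually_lt hd' hlt,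
    hc.eventually_const_lt (mul_pos (by linarith) (by linarith))] with n hn h1 h2 x hx
  obtain ⟨hn, hαn⟩ := hn
  have hn0 : (0 : ℝ) < n := by exact_mod_cast hn
  have hconv := convexOn_scaledDiscr hn (hα n) (hβ n)
  have hx1 := mem_Ioo_of_jacobiP_eq_zero (hα n) (hβ n) hx
  by_contra! hle
  refine jacobiP_ne_zero_of_jacobiDiscr_nonneg_right (hα n) (hβ n) hx1 (fun y hy => ?_) hx
  have hs : 0 < α n / n := by positivity
  have hyd : d < α n / n * (y + 1) := hle.trans_lt (mul_lt_mul_of_pos_left (by linarith [hy.1]) hs)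
  have h3 := hconv.le_right_of_left_le (Set.mem_univ c) (Set.mem_univ (α n / n * (y + 1)))
    (z := d) (by rw [openSegment_eq_Ioo (hcd.trans hyd)]; exact ⟨hcd, hyd⟩) h1.le
  have h4 := (h2.trans h1).trans_le h3
  rw [scaledDiscr, show -1 + n / α n * (α n / n * (y + 1)) = y by field_simp; ring] at h4
  exact ((div_pos_iff_of_pos_right (by positivity)).1 h4).le

lemma eventually_lt_zero (hb : 0 ≤ b) (hα : ∀ n, -1 < α n) (hβ : ∀ n, -1 < β n)
    (hαlim : Tendsto (fun n : ℕ => α n / n) atTop atTop)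
    (hβlim : Tendsto (fun n : ℕ => β n / n) atTop (𝓝 b)) {c : ℝ} (hc : c < leftEnd b) :
    ∀ᶠ n : ℕ in atTop, ∀ x, jacobiP n (α n) (β n) x = 0 → c < α n / n * (x + 1) := by
  have hAB := leftEnd_lt_rightEnd hb
  obtain ⟨d, hcd, hdA⟩ := exists_between hc
  have hc' := tendsto_scaledDiscr hαlim hβlim c
  have hd := tendsto_scaledDiscr hαlim hβlim d
  rw [sub_leftEnd_mul_sub_rightEnd hb] at hc' hd
  have hlt : (d - leftEnd b) * (d - rightEnd b) < (c - leftEnd b) * (c - rightEnd b) := by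
    nlinarith
  filter_upwards [eventually_pos_of_tendsto_div hαlim, hd.eventually_lt hc' hlt,
    hd.eventually_const_lt (mul_pos_of_neg_of_neg (by linarith) (by linarith))] with n hn h1 h2 x hx
  obtain ⟨hn, hαn⟩ := hn
  have hn0 : (0 : ℝ) < n := by exact_mod_cast hn
  have hconv := convexOn_scaledDiscr hn (hα n) (hβ n)
  have hx1 := mem_Ioo_of_jacobiP_eq_zero (hα n) (hβ n) hx
  by_contra! hle
  refine jacobiP_ne_zero_of_jacobiDiscr_nonneg_left (hα n) (hβ n) hx1 (fun y hy => ?_) hx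
  have hs : 0 < α n / n := by positivity
  have hyc : α n / n * (y + 1) < c := (mul_lt_mul_of_pos_left (by linarith [hy.2]) hs).trans_le hle
  have h3 := hconv.le_left_of_right_le (Set.mem_univ (α n / n * (y + 1))) (Set.mem_univ d)
    (z := c) (by rw [openSegment_eq_Ioo (hyc.trans hcd)]; exact ⟨hyc, hcd⟩) h1.le
  have h4 := (h2.trans h1).trans_le h3
  rw [scaledDiscr, show -1 + n / α n * (α n / n * (y + 1)) = y by field_simp; ring] at h4
  exact ((div_pos_iff_of_pos_right (by positivity)).1 h4).le

lemma eventually_exists_zero (hb : 0 ≤ b) (hα : ∀ n, -1 < α n) (hβ : ∀ n, -1 < β n)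
    (hαlim : Tendsto (fun n : ℕ => α n / n) atTop atTop)
    (hβlim : Tendsto (fun n : ℕ => β n / n) atTop (𝓝 b)) {c d : ℝ} (hc : leftEnd b < c)
    (hcd : c < d) (hd : d < rightEnd b) :
    ∀ᶠ n : ℕ in atTop, ∃ x, jacobiP n (α n) (β n) x = 0 ∧
      α n / n * (x + 1) ∈ Set.Icc c d := by
  have hc0 : 0 < c := (leftEnd_nonneg hb).trans_lt hc
  have hd0 : 0 < d := hc0.trans hcd
  have hclim := tendsto_scaledDiscr hαlim hβlim c
  have hdlim := tendsto_scaledDiscr hαlim hβlim d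
  rw [sub_leftEnd_mul_sub_rightEnd hb] at hclim hdlim
  obtain ⟨δ, hδ, hδc, hδd⟩ : ∃ δ : ℝ, 0 < δ ∧ (c - leftEnd b) * (c - rightEnd b) < -δ ^ 2 ∧
      (d - leftEnd b) * (d - rightEnd b) < -δ ^ 2 := by
    have h1 : (c - leftEnd b) * (c - rightEnd b) < 0 :=
      mul_neg_of_pos_of_neg (by linarith) (by linarith)
    have h2 : (d - leftEnd b) * (d - rightEnd b) < 0 :=
      mul_neg_of_pos_of_neg (by linarith) (by linarith)
    have hcont : Tendsto (fun δ : ℝ => -δ ^ 2) (𝓝[>] 0) (𝓝 0) :=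
      ((continuous_id.pow 2).neg.tendsto' 0 0 (by simp)).mono_left nhdsWithin_le_nhds
    obtain ⟨δ, hδ, h⟩ := (eventually_mem_nhdsWithin.and ((hcont.eventually_const_lt h1).and
      (hcont.eventually_const_lt h2))).exists
    exact ⟨δ, hδ, h⟩
  have hbig : Tendsto (fun n : ℕ => δ * (d - c) / (4 * d) * (n : ℝ)) atTop atTop :=
    tendsto_natCast_atTop_atTop.const_mul_atTop
      (div_pos (mul_pos hδ (sub_pos.2 hcd)) (by positivity))
  filter_upwards [eventually_pos_of_tendsto_div hαlim, hclim.eventually_lt_const hδc,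
    hdlim.eventually_lt_const hδd, hbig.eventually_gt_atTop Real.pi,
    hαlim.eventually_gt_atTop d] with n hn h1 h2 h3 h4
  obtain ⟨hn, hαn⟩ := hn
  have hn0 : (0 : ℝ) < n := by exact_mod_cast hn
  have hh : 0 < n / α n := by positivity
  have hconv := convexOn_scaledDiscr hn (hα n) (hβ n)
  have hhd : n / α n * d < 1 := by
    rw [div_mul_eq_mul_div, div_lt_one hαn]
    rwa [lt_div_iff₀ hn0, mul_comm] at h4
  obtain ⟨x, hx, hx0⟩ := exists_jacobiP_eq_zero (n := n) (α := α n) (β := β n)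
    (u := -1 + n / α n * c) (v := -1 + n / α n * d) (K := δ * α n / (4 * d))
    (by nlinarith) (by linarith) (by positivity)
    (h3.trans_eq (by field_simp; ring)) (fun x hx => by
      set t := α n / n * (x + 1) with ht
      have hxt : x = -1 + n / α n * t := by rw [ht]; field_simp; ring
      have htc : c ≤ t := by
        have := hx.1
        rw [hxt] at this
        exact le_of_mul_le_mul_left (by linarith) hh
      have htd : t ≤ d := by
        have := hx.2
        rw [hxt] at this
        exact le_of_mul_le_mul_left (by linarith) hh
      have hmax := hconv.le_max_of_mem_Icc (Set.mem_univ c) (Set.mem_univ d) ⟨htc, htd⟩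
      have hle : scaledDiscr n (α n) (β n) t ≤ -δ ^ 2 := hmax.trans (max_le h1.le h2.le)
      rw [scaledDiscr, ← hxt, div_le_iff₀ (by positivity)] at hle
      refine hle.trans ?_
      have hσ0 : 0 ≤ 1 - x ^ 2 := by
        have := hx.1
        have := hx.2
        have : 0 < n / α n * c := by positivity
        nlinarith
      have hσ : 1 - x ^ 2 ≤ 2 * (n / α n * d) := by
        have := hx.2
        nlinarith [sq_nonneg (x + 1)]
      have hσ2 := pow_le_pow_left₀ hσ0 hσ 2
      have := mul_le_mul_of_nonneg_left hσ2 (show 0 ≤ (δ * α n / (4 * d)) ^ 2 * 4 by positivity)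
      have e : (δ * α n / (4 * d)) ^ 2 * 4 * (2 * (n / α n * d)) ^ 2 = δ ^ 2 * n ^ 2 := by
        field_simp
        ring
      linarith)
  refine ⟨x, hx0, ?_, ?_⟩
  · rw [← div_le_iff₀' (by positivity)]
    have := hx.1
    rw [div_div_eq_mul_div]
    rw [div_mul_eq_mul_div, mul_comm] at this
    linarith
  · rw [← le_div_iff₀' (by positivity)]
    have := hx.2
    rw [div_div_eq_mul_div]
    rw [div_mul_eq_mul_div, mul_comm] at this
    linarith

end Zeros

theorem stmt11 (α β : ℕ → ℝ) (b : ℝ) (hb : 0 ≤ b)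
    (hα : ∀ n, α n > -1) (hβ : ∀ n, β n > -1)
    (hαlim : Tendsto (fun n : ℕ => α n / n) atTop atTop)
    (hβlim : Tendsto (fun n : ℕ => β n / n) atTop (𝓝 b))
    (r s : ℕ → ℝ)
    (hr : ∀ n : ℕ, 1 ≤ n → IsLeast {x : ℝ | jacobiP n (α n) (β n) x = 0} (r n))
    (hs : ∀ n : ℕ, 1 ≤ n → IsGreatest {x : ℝ | jacobiP n (α n) (β n) x = 0} (s n)) :
    Tendsto (fun n : ℕ => α n / n * (s n + 1))
      atTop (𝓝 (2 * (2 + b) + 4 * Real.sqrt (1 + b))) ∧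
    Tendsto (fun n : ℕ => α n / n * (r n + 1))
      atTop (𝓝 (2 * (2 + b) - 4 * Real.sqrt (1 + b))) ∧
    Set.Icc (2 * (2 + b) - 4 * Real.sqrt (1 + b)) (2 * (2 + b) + 4 * Real.sqrt (1 + b)) ⊆
      closure (⋃ n : ℕ, ⋃ _ : 1 ≤ n,
        (fun x => α n / n * (x + 1)) '' {x : ℝ | jacobiP n (α n) (β n) x = 0}) := by
  change Tendsto _ atTop (𝓝 (rightEnd b)) ∧ Tendsto _ atTop (𝓝 (leftEnd b)) ∧
    Set.Icc (leftEnd b) (rightEnd b) ⊆ _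
  have hAB := leftEnd_lt_rightEnd hb
  refine ⟨tendsto_order.2 ⟨fun a ha => ?_, fun a ha => ?_⟩,
    tendsto_order.2 ⟨fun a ha => ?_, fun a ha => ?_⟩, ?_⟩
  · obtain ⟨c, hc, hcB⟩ := exists_between (max_lt ha hAB)
    obtain ⟨d, hcd, hdB⟩ := exists_between hcB
    filter_upwards [eventually_pos_of_tendsto_div hαlim, eventually_exists_zero hb hα hβ hαlim
      hβlim ((le_max_right _ _).trans_lt hc) hcd hdB] with n hn ⟨x, hx, hxc, _⟩
    have hαn := hn.2
    have hxs : x ≤ s n := (hs n hn.1).2 hx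
    exact ((le_max_left _ _).trans_lt hc).trans_le (hxc.trans (by gcongr))
  · filter_upwards [eventually_ge_atTop 1, eventually_zero_lt hb hα hβ hαlim hβlim ha] with n hn h
    exact h _ (hs n hn).1
  · filter_upwards [eventually_ge_atTop 1, eventually_lt_zero hb hα hβ hαlim hβlim ha] with n hn h
    exact h _ (hr n hn).1
  · obtain ⟨d, hAd, hd⟩ := exists_between (lt_min ha hAB)
    obtain ⟨c, hAc, hcd⟩ := exists_between hAd
    filter_upwards [eventually_pos_of_tendsto_div hαlim, eventually_exists_zero hb hα hβ hαlim
      hβlim hAc hcd (hd.trans_le (min_le_right _ _))] with n hn ⟨x, hx, _, hxd⟩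
    have hαn := hn.2
    have hrx : r n ≤ x := (hr n hn.1).2 hx
    exact (le_trans (by gcongr) hxd).trans_lt (hd.trans_le (min_le_left _ _))
  · rw [← closure_Ioo hAB.ne]
    refine closure_minimal (fun p hp => ?_) isClosed_closure
    refine Metric.mem_closure_iff.2 fun ε hε => ?_
    obtain ⟨d, hpd, hd⟩ := exists_between (lt_min hp.2 (lt_add_of_pos_right p hε))
    obtain ⟨n, hn, x, hx, hpx, hxd⟩ := ((eventually_ge_atTop 1).and (eventually_exists_zero hb hα
      hβ hαlim hβlim hp.1 hpd (hd.trans_le (min_le_left _ _)))).exists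
    refine ⟨_, Set.mem_iUnion₂.2 ⟨n, hn, x, hx, rfl⟩, ?_⟩
    have := hd.trans_le (min_le_right _ _)
    rw [dist_comm, Real.dist_eq, abs_of_nonneg (by linarith)]
    linarith
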